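/- Null intersection lemma, part (iii) (Lemma 3.1(iii)): Assume e ∈ N and that e+V has the Weierstrass surjectivity property. Then the ℂ-linear subspace 𝔭·e := {x·e − e·x : x ∈ 𝔭} of 𝔪 satisfies dim(𝔭·e) ≤ dim 𝔪 − dim V (dimensions as finite-dimensional ℂ-vector spaces). -/

import Mathlib

open Matrix

abbrev Mat (n : ℕ) : Type := Matrix (Fin n) (Fin n) ℂ

/-- The nilradical `𝔪` of the parabolic: strictly block upper triangular matrices. -/
def mRad (n k : ℕ) (β : Fin n → Fin k) : Set (Mat n) :=
  {x | ∀ i j, β j ≤ β i → x i j = 0}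

/-- The parabolic subalgebra `𝔭`: block upper triangular matrices. -/
def pPar (n k : ℕ) (β : Fin n → Fin k) : Set (Mat n) :=
  {x | ∀ i j, β j < β i → x i j = 0}

/-- The parabolic group `P`: invertible block upper triangular matrices. -/
def Pgrp (n k : ℕ) (β : Fin n → Fin k) : Set (Mat n) :=
  {g | IsUnit g ∧ ∀ i j, β j < β i → g i j = 0}

/-- The derived group `P'`: elements of `P` whose diagonal blocks have determinant `1`. -/
def Pder (n k : ℕ) (β : Fin n → Fin k) : Set (Mat n) :=
  {g | g ∈ Pgrp n k β ∧ ∀ b : Fin k,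
    (g.submatrix (fun i : {i : Fin n // β i = b} => (i : Fin n))
      (fun i : {i : Fin n // β i = b} => (i : Fin n))).det = 1}

/-- Index type for the matrix coordinates `x i j` with `β i < β j`, i.e. coordinates on `𝔪`. -/
abbrev CoordIdx (n k : ℕ) (β : Fin n → Fin k) : Type :=
  {p : Fin n × Fin n // β p.1 < β p.2}

/-- Evaluation of a polynomial function on `𝔪` at a matrix `y`. -/
noncomputable def evalAt (n k : ℕ) (β : Fin n → Fin k) (y : Mat n)
    (f : MvPolynomial (CoordIdx n k β) ℂ) : ℂ :=
  MvPolynomial.eval (fun p => y p.val.1 p.val.2) f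

/-- `P'`-invariance of a polynomial function on `𝔪`. -/
def PInvariant (n k : ℕ) (β : Fin n → Fin k)
    (f : MvPolynomial (CoordIdx n k β) ℂ) : Prop :=
  ∀ g ∈ Pder n k β, ∀ y ∈ mRad n k β,
    evalAt n k β (g * y * g⁻¹) f = evalAt n k β y f

/-- The nilfibre `𝒩`: common zeros in `𝔪` of the `P'`-invariant polynomial functions
homogeneous of positive degree. -/
def Nilfibre (n k : ℕ) (β : Fin n → Fin k) : Set (Mat n) :=
  {y | y ∈ mRad n k β ∧ ∀ d : ℕ, 1 ≤ d →
    ∀ f : MvPolynomial (CoordIdx n k β) ℂ,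
      f.IsHomogeneous d → PInvariant n k β f → evalAt n k β y f = 0}

/-- The Weierstrass surjectivity property for the affine translate `e + V`. -/
def WSurj (n k : ℕ) (β : Fin n → Fin k) (e : Mat n) (V : Submodule ℂ (Mat n)) : Prop :=
  ∀ ξ : V →ₗ[ℂ] ℂ, ∃ d : ℕ, 1 ≤ d ∧ ∃ f : MvPolynomial (CoordIdx n k β) ℂ,
    f.IsHomogeneous d ∧ PInvariant n k β f ∧
      ∀ v : V, evalAt n k β (e + (v : Mat n)) f = ξ v

/-- `𝔭` as a `ℂ`-subspace of the matrices. -/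
noncomputable def pSub (n k : ℕ) (β : Fin n → Fin k) : Submodule ℂ (Mat n) where
  carrier := pPar n k β
  add_mem' := by
    intro a b ha hb i j h
    simp [Matrix.add_apply, ha i j h, hb i j h]
  zero_mem' := by
    intro i j h
    simp
  smul_mem' := by
    intro c x hx i j h
    simp [Matrix.smul_apply, hx i j h]

/-- `𝔪` as a `ℂ`-subspace of the matrices. -/
noncomputable def mSub (n k : ℕ) (β : Fin n → Fin k) : Submodule ℂ (Mat n) where
  carrier := mRad n k β
  add_mem' := by
    intro a b ha hb i j h
    simp [Matrix.add_apply, ha i j h, hb i j h]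
  zero_mem' := by
    intro i j h
    simp
  smul_mem' := by
    intro c x hx i j h
    simp [Matrix.smul_apply, hx i j h]

lemma aux_poly_deriv {σ : Type} [Fintype σ] [DecidableEq σ] (f : MvPolynomial σ ℂ) (p : σ → ℂ)
    (w : σ → ℂ) (c : ℂ → σ → ℂ) (h0 : c 0 = p) (hc : ∀ i, HasDerivAt (fun t => c t i) (w i) 0) :
    HasDerivAt (fun t => MvPolynomial.eval (c t) f)
      (∑ i, MvPolynomial.eval p (MvPolynomial.pderiv i f) * w i) 0 := by
  induction f using MvPolynomial.induction_on with
  | C a => simpa using hasDerivAt_const (0 : ℂ) a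
  | add f g hf hg =>
    have h1 := hf.add hg
    have h2 : (∑ i, MvPolynomial.eval p (MvPolynomial.pderiv i (f + g)) * w i) =
      (∑ i, MvPolynomial.eval p (MvPolynomial.pderiv i f) * w i) +
      (∑ i, MvPolynomial.eval p (MvPolynomial.pderiv i g) * w i) := by
      simp only [map_add, add_mul, Finset.sum_add_distrib]
    have h3 : (fun t => MvPolynomial.eval (c t) (f + g)) =
        (fun t => MvPolynomial.eval (c t) f) + (fun t => MvPolynomial.eval (c t) g) := by
      funext t; simp
    rw [h2, h3]
    exact h1
  | mul_X f j hf =>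
    have h1 := hf.mul (hc j)
    have h3 : (fun t => MvPolynomial.eval (c t) (f * MvPolynomial.X j)) =
        (fun t => MvPolynomial.eval (c t) f) * (fun t => c t j) := by
      funext t; simp
    have h2 : (∑ i, MvPolynomial.eval p (MvPolynomial.pderiv i (f * MvPolynomial.X j)) * w i) =
      (∑ i, MvPolynomial.eval p (MvPolynomial.pderiv i f) * w i) * c 0 j +
        MvPolynomial.eval (c 0) f * w j := by
      simp only [Derivation.leibniz, MvPolynomial.pderiv_X, map_add, smul_eq_mul, map_mul,
        MvPolynomial.eval_X, add_mul, Finset.sum_add_distrib, h0]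
      rw [add_comm]
      congr 1
      · rw [Finset.sum_mul]
        refine Finset.sum_congr rfl fun i _ => by ring
      · rw [Finset.sum_eq_single j]
        · simp
        · intro b _ hb
          simp [Pi.single_apply, hb.symm]
        · simp
    rw [h2, h3]
    exact h1

lemma aux_inv_mem (n k : ℕ) (β : Fin n → Fin k) {g : Mat n} (hg : g ∈ Pgrp n k β) :
    g⁻¹ ∈ Pgrp n k β := by
  obtain ⟨hu, ht⟩ := hg
  have := hu.invertible
  refine ⟨?_, ?_⟩
  · exact Matrix.isUnit_nonsing_inv_iff.2 hu
  · have : Matrix.BlockTriangular g β := fun i j h => ht i j h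
    have h2 := Matrix.blockTriangular_inv_of_blockTriangular this
    exact fun i j h => h2 h

lemma aux_mul_mem (n k : ℕ) (β : Fin n → Fin k) {g h : Mat n} (hg : g ∈ Pgrp n k β)
    (hh : h ∈ Pgrp n k β) : g * h ∈ Pgrp n k β := by
  refine ⟨hg.1.mul hh.1, ?_⟩
  have h1 : Matrix.BlockTriangular g β := fun i j h => hg.2 i j h
  have h2 : Matrix.BlockTriangular h β := fun i j h => hh.2 i j h
  exact fun i j h => (h1.mul h2) h

lemma aux_p_mul_m (n k : ℕ) (β : Fin n → Fin k) {x y : Mat n} (hx : x ∈ pPar n k β)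
    (hy : y ∈ mRad n k β) : x * y ∈ mRad n k β := by
  intro i j hij
  rw [Matrix.mul_apply]
  refine Finset.sum_eq_zero fun l _ => ?_
  by_cases h : β l < β i
  · rw [hx i l h, zero_mul]
  · rw [hy l j (hij.trans (not_lt.1 h)), mul_zero]

lemma aux_m_mul_p (n k : ℕ) (β : Fin n → Fin k) {x y : Mat n} (hx : x ∈ pPar n k β)
    (hy : y ∈ mRad n k β) : y * x ∈ mRad n k β := by
  intro i j hij
  rw [Matrix.mul_apply]
  refine Finset.sum_eq_zero fun l _ => ?_
  by_cases h : β j < β l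
  · rw [hx l j h, mul_zero]
  · rw [hy i l ((not_lt.1 h).trans hij), zero_mul]

lemma aux_conj_m (n k : ℕ) (β : Fin n → Fin k) {g y : Mat n} (hg : g ∈ Pgrp n k β)
    (hy : y ∈ mRad n k β) : g * y * g⁻¹ ∈ mRad n k β :=
  aux_m_mul_p n k β (aux_inv_mem n k β hg).2 (aux_p_mul_m n k β hg.2 hy)

lemma aux_block_mul (n k : ℕ) (β : Fin n → Fin k) {g h : Mat n} (hg : g ∈ Pgrp n k β)
    (hh : h ∈ Pgrp n k β) (b : Fin k) :
    ((g * h).submatrix (fun i : {i : Fin n // β i = b} => (i : Fin n))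
      (fun i : {i : Fin n // β i = b} => (i : Fin n))).det =
    (g.submatrix (fun i : {i : Fin n // β i = b} => (i : Fin n))
      (fun i : {i : Fin n // β i = b} => (i : Fin n))).det *
    (h.submatrix (fun i : {i : Fin n // β i = b} => (i : Fin n))
      (fun i : {i : Fin n // β i = b} => (i : Fin n))).det := by
  rw [← Matrix.det_mul]
  congr 1
  ext ⟨i, hi⟩ ⟨j, hj⟩
  simp only [Matrix.submatrix_apply, Matrix.mul_apply]
  have h1 : ∀ F : Fin n → ℂ, (∀ l, β l ≠ b → F l = 0) →
      ∑ l, F l = ∑ l : {l : Fin n // β l = b}, F l := by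
    intro F hF
    rw [← Finset.sum_subtype (Finset.univ.filter (fun l => β l = b)) (by simp) F]
    refine (Finset.sum_subset (Finset.subset_univ _) ?_).symm
    intro l _ hl
    exact hF l (by simpa using hl)
  refine h1 (fun l => g i l * h l j) fun l hl => ?_
  rcases lt_or_gt_of_ne hl with h2 | h2
  · simp only [hg.2 i l (by rw [hi]; exact h2), zero_mul]
  · simp only [hh.2 l j (by rw [hj]; exact h2), mul_zero]

lemma aux_conj_der (n k : ℕ) (β : Fin n → Fin k) {g h : Mat n} (hg : g ∈ Pder n k β)
    (hh : h ∈ Pgrp n k β) : h * g * h⁻¹ ∈ Pder n k β := by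
  have hi := aux_inv_mem n k β hh
  refine ⟨aux_mul_mem n k β (aux_mul_mem n k β hh hg.1) hi, fun b => ?_⟩
  rw [aux_block_mul n k β (aux_mul_mem n k β hh hg.1) hi, aux_block_mul n k β hh hg.1, hg.2 b,
    mul_one, ← aux_block_mul n k β hh hi, Matrix.mul_nonsing_inv _ ((Matrix.isUnit_iff_isUnit_det _).1 hh.1),
    Matrix.submatrix_one _ Subtype.val_injective, Matrix.det_one]

noncomputable def auxTw (n k : ℕ) (β : Fin n → Fin k) (h : Mat n)
    (f : MvPolynomial (CoordIdx n k β) ℂ) : MvPolynomial (CoordIdx n k β) ℂ :=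
  MvPolynomial.aeval (fun p : CoordIdx n k β => ∑ q : CoordIdx n k β,
    MvPolynomial.C (h p.val.1 q.val.1 * h⁻¹ q.val.2 p.val.2) * MvPolynomial.X q) f

lemma auxTw_hom (n k : ℕ) (β : Fin n → Fin k) (h : Mat n)
    (f : MvPolynomial (CoordIdx n k β) ℂ) (d : ℕ) (hf : f.IsHomogeneous d) :
    (auxTw n k β h f).IsHomogeneous d := by
  have h1 : ∀ p : CoordIdx n k β, (∑ q : CoordIdx n k β,
      MvPolynomial.C (h p.val.1 q.val.1 * h⁻¹ q.val.2 p.val.2) *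
        (MvPolynomial.X q : MvPolynomial (CoordIdx n k β) ℂ)).IsHomogeneous 1 := by
    intro p
    refine MvPolynomial.IsHomogeneous.sum _ _ _ fun q _ => ?_
    exact MvPolynomial.IsHomogeneous.C_mul (MvPolynomial.isHomogeneous_X ℂ q) _
  have h2 := hf.aeval _ h1
  rw [one_mul] at h2
  exact h2

lemma auxTw_eval (n k : ℕ) (β : Fin n → Fin k) (h : Mat n)
    (f : MvPolynomial (CoordIdx n k β) ℂ) (y : Mat n) (hy : y ∈ mRad n k β) :
    evalAt n k β y (auxTw n k β h f) = evalAt n k β (h * y * h⁻¹) f := by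
  have hp : ∀ a b : Fin n, (h * y * h⁻¹) a b =
      ∑ q : CoordIdx n k β, h a q.val.1 * h⁻¹ q.val.2 b * y q.val.1 q.val.2 := by
    intro a b
    have h1 : ∀ F : Fin n × Fin n → ℂ, (∀ l, ¬ β l.1 < β l.2 → F l = 0) →
        ∑ l, F l = ∑ l : CoordIdx n k β, F l := by
      intro F hF
      rw [← Finset.sum_subtype (Finset.univ.filter
        (fun l : Fin n × Fin n => β l.1 < β l.2)) (by simp) F]
      refine (Finset.sum_subset (Finset.subset_univ _) ?_).symm
      intro l _ hl
      exact hF l (by simpa using hl)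
    rw [← h1 (fun q => h a q.1 * h⁻¹ q.2 b * y q.1 q.2)
      (fun l hl => by simp only [hy l.1 l.2 (not_lt.1 hl), mul_zero])]
    rw [Fintype.sum_prod_type_right, Matrix.mul_apply]
    refine Finset.sum_congr rfl fun j _ => ?_
    rw [Matrix.mul_apply, Finset.sum_mul]
    exact Finset.sum_congr rfl fun i _ => by ring
  unfold evalAt auxTw
  simp only [hp]
  induction f using MvPolynomial.induction_on with
  | C a => simp
  | add f g hf hg => simp only [map_add, hf, hg]
  | mul_X f j hf =>
    rw [map_mul, map_mul, hf, map_mul]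
    simp only [map_mul, MvPolynomial.aeval_X, MvPolynomial.eval_X, map_sum,
      MvPolynomial.eval_C]

lemma aux_nil (n k : ℕ) (β : Fin n → Fin k) (e h : Mat n) (heN : e ∈ Nilfibre n k β)
    (hh : h ∈ Pgrp n k β) (d : ℕ) (hd : 1 ≤ d) (f : MvPolynomial (CoordIdx n k β) ℂ)
    (hf : f.IsHomogeneous d) (hi : PInvariant n k β f) :
    evalAt n k β (h * e * h⁻¹) f = 0 := by
  rw [← auxTw_eval n k β h f e heN.1]
  refine heN.2 d hd _ (auxTw_hom n k β h f d hf) ?_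
  intro g hg y hy
  rw [auxTw_eval n k β h f _ (aux_conj_m n k β hg.1 hy), auxTw_eval n k β h f y hy]
  have := hi _ (aux_conj_der n k β hg hh) _ (aux_conj_m n k β hh hy)
  rw [← this]
  congr 1
  have hu := (Matrix.isUnit_iff_isUnit_det _).1 hh.1
  rw [Matrix.mul_inv_rev, Matrix.mul_inv_rev, Matrix.nonsing_inv_nonsing_inv _ hu]
  simp only [Matrix.mul_assoc]
  rw [Matrix.nonsing_inv_mul_cancel_left _ _ hu, Matrix.nonsing_inv_mul_cancel_left _ _ hu]

section
attribute [local instance] Matrix.linftyOpNormedRing Matrix.linftyOpNormedAlgebra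

lemma aux_curve (n : ℕ) (e x : Mat n) :
    (∀ᶠ t : ℂ in nhds 0, IsUnit (1 + t • x : Mat n)) ∧
    ∀ i j, HasDerivAt (fun t : ℂ => ((1 + t • x) * e * (1 + t • x)⁻¹ : Mat n) i j)
      ((x * e - e * x) i j) 0 := by
  have hl : HasDerivAt (fun t : ℂ => (1 + t • x : Mat n)) x 0 := by
    have := ((hasDerivAt_id (0 : ℂ)).smul_const x).const_add (1 : Mat n)
    rw [one_smul] at this
    exact this
  constructor
  · have : IsOpen {y : Mat n | IsUnit y} := Units.isOpen
    exact hl.continuousAt.eventually (this.mem_nhds (by simp))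
  · have h1 := hasFDerivAt_ringInverse (𝕜 := ℂ) (1 : (Mat n)ˣ)
    have h2 : HasDerivAt (fun t : ℂ => (1 + t • x : Mat n)⁻¹) (-x) 0 := by
      have h0 : ((1 : (Mat n)ˣ) : Mat n) = (fun t : ℂ => (1 + t • x : Mat n)) 0 := by simp
      have h3 := h1
      rw [h0] at h3
      have := h3.comp_hasDerivAt (0 : ℂ) hl
      simp only [Matrix.nonsing_inv_eq_ringInverse]
      simp at this
      exact this
    have h4 := (hl.mul_const e).mul h2
    intro i j
    have h5 := (hasDerivAt_pi.1 ((hasDerivAt_pi.1 h4) i)) j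
    have h6 : x * e - e * x = x * e * (1 + (0 : ℂ) • x : Mat n)⁻¹ +
        (1 + (0 : ℂ) • x : Mat n) * e * (-x) := by
      simp [sub_eq_add_neg]
    rw [h6]
    exact h5
end

/-- Lemma 3.1(iii): `dim 𝔭.e ≤ dim 𝔪 − dim V`, where `𝔭.e = {x·e − e·x : x ∈ 𝔭}`. -/
theorem stmt2 (n k : ℕ) (hn : 0 < n) (hk : 0 < k)
    (β : Fin n → Fin k) (hmono : Monotone β) (hsurj : Function.Surjective β)
    (e : Mat n) (he : e ∈ mRad n k β)
    (V : Submodule ℂ (Mat n)) (hV : (V : Set (Mat n)) ⊆ mRad n k β)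
    (heN : e ∈ Nilfibre n k β) (hW : WSurj n k β e V) :
    Module.finrank ℂ
        (Submodule.map (LinearMap.mulRight ℂ e - LinearMap.mulLeft ℂ e) (pSub n k β))
      ≤ Module.finrank ℂ (mSub n k β) - Module.finrank ℂ V := by
  set L := LinearMap.mulRight ℂ e - LinearMap.mulLeft ℂ e with hL
  have hLx : ∀ x, L x = x * e - e * x := fun x => by simp [hL]
  have hle : Submodule.map L (pSub n k β) ≤ mSub n k β := by
    rintro _ ⟨x, hx, rfl⟩
    rw [hLx]
    exact (mSub n k β).sub_mem (aux_p_mul_m n k β hx he) (aux_m_mul_p n k β hx he)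
  have hVle : V ≤ mSub n k β := hV
  have hdisj : Submodule.map L (pSub n k β) ⊓ V = ⊥ := by
    rw [eq_bot_iff]
    rintro _ ⟨⟨x, hx, rfl⟩, hv⟩
    rw [Submodule.mem_bot]
    have key : ∀ ξ : V →ₗ[ℂ] ℂ, ξ ⟨L x, hv⟩ = 0 := by
      intro ξ
      obtain ⟨d, hd, f, hf, hi, hξ⟩ := hW ξ
      obtain ⟨hu, hc⟩ := aux_curve n e x
      have d1 := aux_poly_deriv f (fun p => e p.val.1 p.val.2) (fun p => (x * e - e * x) p.val.1 p.val.2)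
        (fun t p => ((1 + t • x) * e * (1 + t • x)⁻¹ : Mat n) p.val.1 p.val.2) (by simp)
        (fun p => hc _ _)
      have d2 := aux_poly_deriv f (fun p => e p.val.1 p.val.2) (fun p => (x * e - e * x) p.val.1 p.val.2)
        (fun t p => (e + t • (x * e - e * x) : Mat n) p.val.1 p.val.2) (by simp)
        (fun p => by
          simpa using ((hasDerivAt_id (0 : ℂ)).mul_const ((x * e - e * x) p.val.1 p.val.2)).const_add
            (e p.val.1 p.val.2))
      have e1 : (fun t : ℂ => MvPolynomial.eval (fun p : CoordIdx n k β =>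
          ((1 + t • x) * e * (1 + t • x)⁻¹ : Mat n) p.val.1 p.val.2) f) =ᶠ[nhds 0] fun _ => 0 := by
        filter_upwards [hu] with t ht
        refine aux_nil n k β e _ heN ⟨ht, fun i j hij => ?_⟩ d hd f hf hi
        have h1 : i ≠ j := by rintro rfl; exact lt_irrefl _ hij
        simp [hx i j hij, h1]
      have e2 : (fun t : ℂ => MvPolynomial.eval (fun p : CoordIdx n k β =>
          (e + t • (x * e - e * x) : Mat n) p.val.1 p.val.2) f) = fun t => t * ξ ⟨L x, hv⟩ := by
        funext t
        have := hξ (t • ⟨L x, hv⟩)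
        rw [map_smul, smul_eq_mul] at this
        rw [← this, Submodule.coe_smul]
        change _ = evalAt n k β (e + t • L x) f
        rw [hLx]
        rfl
      rw [e2] at d2
      have d3 := (hasDerivAt_const (0 : ℂ) (0 : ℂ)).congr_of_eventuallyEq e1
      have d4 := (hasDerivAt_id (0 : ℂ)).mul_const (ξ ⟨L x, hv⟩)
      have := d4.unique d2
      rw [one_mul] at this
      rw [this, d1.unique d3]
    have := (Module.forall_dual_apply_eq_zero_iff ℂ (⟨L x, hv⟩ : V)).1 key
    simpa using congrArg Subtype.val this
  have h1 := Submodule.finrank_sup_add_finrank_inf_eq (Submodule.map L (pSub n k β)) V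
  rw [hdisj, finrank_bot, add_zero] at h1
  have h2 := Submodule.finrank_mono (sup_le hle hVle)
  omega
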